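/- Let C be a skeletally small triangulated category and let H be a Q-subspace of G(C)_Q. Then there exists a radical dense subcategory D of C such that image(δ^D_Q) = H. -/

import Mathlib

open CategoryTheory CategoryTheory.Limits CategoryTheory.Pretriangulated
open scoped TensorProduct

universe v u

set_option linter.unusedSectionVars false
set_option linter.unusedVariables false

namespace GrothendieckPaper

variable (C : Type u) [Category.{v} C] [Preadditive C] [Limits.HasZeroObject C]
  [HasShift C ℤ] [∀ n : ℤ, (shiftFunctor C n).Additive] [Pretriangulated C]

/-- The set of Euler relations `[V] - [U] - [W]` coming from distinguished triangles
`U ⟶ V ⟶ W ⟶ U⟦1⟧`. -/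
def eulerSet : Set (FreeAbelianGroup C) :=
  { x | ∃ T : Triangle C, (T ∈ distTriang C) ∧
      x = FreeAbelianGroup.of T.obj₂ - FreeAbelianGroup.of T.obj₁ - FreeAbelianGroup.of T.obj₃ }

def eulerSubgroup : AddSubgroup (FreeAbelianGroup C) := AddSubgroup.closure (eulerSet C)

/-- The Grothendieck group of a (skeletally small) triangulated category. -/
def G : Type u := FreeAbelianGroup C ⧸ eulerSubgroup C

instance : AddCommGroup (G C) := QuotientAddGroup.Quotient.addCommGroup _

/-- The class `[U]` of an object `U` in the Grothendieck group. -/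
def cls (U : C) : G C := QuotientAddGroup.mk (FreeAbelianGroup.of U)

/-- A (strictly full) triangulated subcategory of `C`, given by its set of objects:
closed under isomorphisms, under the shifts `[1]` and `[-1]`, and under extensions
(cones): if `X ⟶ Y ⟶ Z ⟶ X⟦1⟧` is distinguished and `X, Y` belong then so does `Z`. -/
structure IsTriangulatedSubcat (S : Set C) : Prop where
  mem_of_iso : ∀ {X Y : C}, (X ≅ Y) → Y ∈ S → X ∈ S
  shift_mem : ∀ {X : C}, X ∈ S → ((shiftFunctor C (1 : ℤ)).obj X) ∈ S
  shift_neg_mem : ∀ {X : C}, X ∈ S → ((shiftFunctor C (-1 : ℤ)).obj X) ∈ S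
  ext_mem : ∀ (T : Triangle C), (T ∈ distTriang C) → T.obj₁ ∈ S → T.obj₂ ∈ S → T.obj₃ ∈ S

/-- `npowAux U n` is the direct sum of `n + 1` copies of `U`. -/
noncomputable def npowAux (U : C) : ℕ → C
  | 0 => U
  | n + 1 => U ⊞ npowAux U n

/-- `npow U n` is the direct sum `U^n` of `n` copies of `U` (for `n ≥ 1`;
`npow U 0` is defined to be `U` as a junk value). -/
noncomputable def npow (U : C) (n : ℕ) : C := npowAux C U (n - 1)

/-- A subcategory (set of objects) `S` is dense in `C` if every object of `C` is a
direct summand of an object of `S`. -/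
def DenseSub (S : Set C) : Prop := ∀ U : C, ∃ V : C, (U ⊞ V) ∈ S

/-- A subcategory `S` is radical if `U^n ∈ S` for some `n ≥ 1` implies `U ∈ S`. -/
def RadicalSub (S : Set C) : Prop := ∀ (U : C) (n : ℕ), 1 ≤ n → npow C U n ∈ S → U ∈ S

/-- `√S = { U | U^n ∈ S for some n ≥ 1 }`. -/
def sqrtSet (S : Set C) : Set C := { U : C | ∃ n : ℕ, 1 ≤ n ∧ npow C U n ∈ S }

lemma subset_sqrtSet (S : Set C) : S ⊆ sqrtSet C S := fun U hU => ⟨1, le_refl 1, hU⟩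

/-- The Euler relations for the full subcategory on `S`, coming from distinguished
triangles of `C` all of whose vertices lie in `S`. -/
def eulerSetSub (S : Set C) : Set (FreeAbelianGroup S) :=
  { x | ∃ (T : Triangle C) (_ : T ∈ distTriang C) (h1 : T.obj₁ ∈ S) (h2 : T.obj₂ ∈ S)
      (h3 : T.obj₃ ∈ S),
      x = FreeAbelianGroup.of (⟨T.obj₂, h2⟩ : S) - FreeAbelianGroup.of ⟨T.obj₁, h1⟩
        - FreeAbelianGroup.of ⟨T.obj₃, h3⟩ }

/-- The Grothendieck group of the triangulated subcategory on the set of objects `S`. -/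
def GSub (S : Set C) : Type u := FreeAbelianGroup S ⧸ AddSubgroup.closure (eulerSetSub C S)

instance (S : Set C) : AddCommGroup (GSub C S) := QuotientAddGroup.Quotient.addCommGroup _

lemma delta_le (S : Set C) :
    AddSubgroup.closure (eulerSetSub C S) ≤
      (eulerSubgroup C).comap (FreeAbelianGroup.map (Subtype.val : S → C)) := by
  rw [AddSubgroup.closure_le]
  rintro x ⟨T, hT, h1, h2, h3, rfl⟩
  simp only [SetLike.mem_coe, AddSubgroup.mem_comap, map_sub, FreeAbelianGroup.map_of_apply]
  exact AddSubgroup.subset_closure ⟨T, hT, rfl⟩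

/-- The natural map `δ^S : G(S) → G(C)` induced by the inclusion of the subcategory. -/
def deltaHom (S : Set C) : GSub C S →+ G C :=
  QuotientAddGroup.map _ _ (FreeAbelianGroup.map (Subtype.val : S → C)) (delta_le C S)

lemma incl_le {S S' : Set C} (h : S ⊆ S') :
    AddSubgroup.closure (eulerSetSub C S) ≤
      (AddSubgroup.closure (eulerSetSub C S')).comap
        (FreeAbelianGroup.map (Set.inclusion h)) := by
  rw [AddSubgroup.closure_le]
  rintro x ⟨T, hT, h1, h2, h3, rfl⟩
  simp only [SetLike.mem_coe, AddSubgroup.mem_comap, map_sub, FreeAbelianGroup.map_of_apply]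
  exact AddSubgroup.subset_closure ⟨T, hT, h h1, h h2, h h3, rfl⟩

/-- The map `G(S) → G(S')` induced by an inclusion `S ⊆ S'` of subcategories. -/
def inclHom {S S' : Set C} (h : S ⊆ S') : GSub C S →+ GSub C S' :=
  QuotientAddGroup.map _ _ (FreeAbelianGroup.map (Set.inclusion h)) (incl_le C h)

/-- `δ^S ⊗ ℚ : G(S)_ℚ → G(C)_ℚ`. -/
noncomputable def deltaQ (S : Set C) : ℚ ⊗[ℤ] GSub C S →ₗ[ℚ] ℚ ⊗[ℤ] G C :=
  LinearMap.baseChange ℚ (deltaHom C S).toIntLinearMap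

/-- The rationalization of the map induced by an inclusion of subcategories. -/
noncomputable def inclQ {S S' : Set C} (h : S ⊆ S') :
    ℚ ⊗[ℤ] GSub C S →ₗ[ℚ] ℚ ⊗[ℤ] GSub C S' :=
  LinearMap.baseChange ℚ (inclHom C h).toIntLinearMap

/-- The collection `I(H)` of dense triangulated subcategories `S` of `C` with
`image(δ^S_ℚ) = H`. -/
def denseFamily (H : Submodule ℚ (ℚ ⊗[ℤ] G C)) : Set (Set C) :=
  { S | IsTriangulatedSubcat C S ∧ DenseSub C S ∧ LinearMap.range (deltaQ C S) = H }


variable {C} in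
lemma cls_obj₂ {T : Triangle C} (hT : T ∈ distTriang C) :
    cls C T.obj₂ = cls C T.obj₁ + cls C T.obj₃ := by
  have h : ((FreeAbelianGroup.of T.obj₂ - FreeAbelianGroup.of T.obj₁ -
      FreeAbelianGroup.of T.obj₃ : FreeAbelianGroup C) : FreeAbelianGroup C ⧸ eulerSubgroup C) =
      0 :=
    (QuotientAddGroup.eq_zero_iff _).2 (AddSubgroup.subset_closure ⟨T, hT, rfl⟩)
  have h' : cls C T.obj₂ - cls C T.obj₁ - cls C T.obj₃ = 0 := h
  rw [sub_sub, sub_eq_zero] at h'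
  exact h'

lemma cls_biprod (X Y : C) : cls C (X ⊞ Y) = cls C X + cls C Y :=
  cls_obj₂ (binaryBiproductTriangle_distinguished X Y)

open ZeroObject in
lemma cls_zero : cls C (0 : C) = 0 := by
  have h := cls_obj₂ (contractible_distinguished (0 : C))
  exact left_eq_add.1 h

variable {C} in
open ZeroObject in
lemma cls_eq_of_iso {X Y : C} (e : X ≅ Y) : cls C X = cls C Y := by
  have hT : Triangle.mk e.hom (0 : Y ⟶ 0) 0 ∈ distTriang C :=
    isomorphic_distinguished _ (contractible_distinguished X) _
      (Triangle.isoMk _ _ (Iso.refl X) e.symm (Iso.refl 0)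
        (e.hom_inv_id.trans (Category.id_comp _).symm) (zero_comp.trans comp_zero.symm)
        (zero_comp.trans comp_zero.symm))
  have h := cls_obj₂ hT
  have h' : cls C Y = cls C X + cls C (0 : C) := h
  rw [cls_zero, add_zero] at h'
  exact h'.symm

open ZeroObject in
lemma cls_shift_one (X : C) : cls C ((shiftFunctor C (1 : ℤ)).obj X) = -cls C X := by
  have h : cls C (0 : C) = cls C X + cls C ((shiftFunctor C (1 : ℤ)).obj X) :=
    cls_obj₂ (rot_of_distTriang _ (contractible_distinguished X))
  rw [cls_zero] at h
  exact (neg_eq_of_add_eq_zero_right h.symm).symm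

lemma cls_shift_neg_one (X : C) : cls C ((shiftFunctor C (-1 : ℤ)).obj X) = -cls C X := by
  have h := cls_shift_one C ((shiftFunctor C (-1 : ℤ)).obj X)
  rw [cls_eq_of_iso (shiftNegShift X (1 : ℤ))] at h
  rw [h, neg_neg]

lemma cls_npowAux (U : C) (n : ℕ) : cls C (npowAux C U n) = (n + 1) • cls C U := by
  induction n with
  | zero => simp [npowAux]
  | succ n ih => rw [npowAux, cls_biprod, ih, succ_nsmul' _ (n + 1)]

lemma cls_npow (U : C) {n : ℕ} (hn : 1 ≤ n) : cls C (npow C U n) = n • cls C U := by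
  rw [npow, cls_npowAux, Nat.sub_add_cancel hn]

open ZeroObject in
lemma cls_surjective : Function.Surjective (cls C) := by
  intro g
  obtain ⟨x, rfl⟩ := QuotientAddGroup.mk_surjective g
  induction x using FreeAbelianGroup.induction_on with
  | zero => exact ⟨0, cls_zero C⟩
  | of X => exact ⟨X, rfl⟩
  | neg X _ => exact ⟨(shiftFunctor C (1 : ℤ)).obj X, cls_shift_one C X⟩
  | add x y hx hy =>
    obtain ⟨X, hX⟩ := hx
    obtain ⟨Y, hY⟩ := hy
    refine ⟨X ⊞ Y, ?_⟩
    rw [cls_biprod, hX, hY]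
    rfl

lemma exists_smul_eq_one_tmul {A : Type*} [AddCommGroup A] (x : ℚ ⊗[ℤ] A) :
    ∃ (n : ℕ) (a : A), n ≠ 0 ∧ (n : ℚ) • x = 1 ⊗ₜ[ℤ] a := by
  induction x using TensorProduct.induction_on with
  | zero => exact ⟨1, 0, one_ne_zero, by simp⟩
  | tmul q a =>
    refine ⟨q.den, q.num • a, q.den_ne_zero, ?_⟩
    rw [TensorProduct.smul_tmul', TensorProduct.tmul_smul, TensorProduct.smul_tmul']
    simp [Rat.den_mul_eq_num]
  | add x y hx hy =>
    obtain ⟨m, a, hm, hx⟩ := hx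
    obtain ⟨n, b, hn, hy⟩ := hy
    refine ⟨m * n, n • a + m • b, mul_ne_zero hm hn, ?_⟩
    rw [TensorProduct.tmul_add, TensorProduct.tmul_smul, TensorProduct.tmul_smul, ← hx, ← hy]
    simp only [← Nat.cast_smul_eq_nsmul ℚ, smul_smul, smul_add, Nat.cast_mul]
    rw [mul_comm (n : ℚ) m]

/-- The objects whose rational class lies in the subspace `H`. -/
def objectsOver (H : Submodule ℚ (ℚ ⊗[ℤ] G C)) : Set C :=
  { U | (1 : ℚ) ⊗ₜ[ℤ] cls C U ∈ H }

lemma mem_objectsOver {H : Submodule ℚ (ℚ ⊗[ℤ] G C)} {U : C} :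
    U ∈ objectsOver C H ↔ (1 : ℚ) ⊗ₜ[ℤ] cls C U ∈ H :=
  Iff.rfl

section

variable (H : Submodule ℚ (ℚ ⊗[ℤ] G C))

lemma isTriangulatedSubcat_objectsOver : IsTriangulatedSubcat C (objectsOver C H) where
  mem_of_iso {X Y} e hY := by
    simpa only [mem_objectsOver, cls_eq_of_iso e] using hY
  shift_mem {X} hX := by
    simpa only [mem_objectsOver, cls_shift_one, TensorProduct.tmul_neg, neg_mem_iff]
      using hX
  shift_neg_mem {X} hX := by
    simpa only [mem_objectsOver, cls_shift_neg_one, TensorProduct.tmul_neg,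
      neg_mem_iff] using hX
  ext_mem T hT h₁ h₂ := by
    have h := H.sub_mem h₂ h₁
    rwa [cls_obj₂ hT, TensorProduct.tmul_add, add_sub_cancel_left] at h

lemma denseSub_objectsOver : DenseSub C (objectsOver C H) := fun U =>
  ⟨(shiftFunctor C (1 : ℤ)).obj U, by
    simp only [mem_objectsOver, cls_biprod, cls_shift_one, add_neg_cancel,
      TensorProduct.tmul_zero, zero_mem]⟩

lemma radicalSub_objectsOver : RadicalSub C (objectsOver C H) := by
  intro U n hn h
  have hn' : (n : ℚ) ≠ 0 := Nat.cast_ne_zero.2 (Nat.one_le_iff_ne_zero.1 hn)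
  simp only [mem_objectsOver, cls_npow C U hn, TensorProduct.tmul_smul] at h
  rw [← Nat.cast_smul_eq_nsmul ℚ] at h
  exact (H.smul_mem_iff hn').1 h

lemma deltaHom_mem_objectsOver (g : GSub C (objectsOver C H)) :
    (1 : ℚ) ⊗ₜ[ℤ] deltaHom C (objectsOver C H) g ∈ H := by
  obtain ⟨x, rfl⟩ := QuotientAddGroup.mk'_surjective _ g
  let π : FreeAbelianGroup (objectsOver C H) →+ GSub C (objectsOver C H) :=
    QuotientAddGroup.mk' (AddSubgroup.closure (eulerSetSub C (objectsOver C H)))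
  change (1 : ℚ) ⊗ₜ[ℤ] deltaHom C (objectsOver C H) (π x) ∈ H
  induction x using FreeAbelianGroup.induction_on with
  | zero => simp only [map_zero, TensorProduct.tmul_zero, zero_mem]
  | of X => exact X.2
  | neg X hX => simpa only [map_neg, TensorProduct.tmul_neg, neg_mem_iff] using hX
  | add x y hx hy =>
    simpa only [map_add, TensorProduct.tmul_add] using H.add_mem hx hy

lemma range_deltaQ_objectsOver : LinearMap.range (deltaQ C (objectsOver C H)) = H := by
  apply le_antisymm
  · rintro _ ⟨x, rfl⟩
    induction x using TensorProduct.induction_on with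
    | zero => rw [map_zero]; exact H.zero_mem
    | tmul q g =>
      have h := H.smul_mem q (deltaHom_mem_objectsOver C H g)
      rw [TensorProduct.smul_tmul', smul_eq_mul, mul_one] at h
      exact h
    | add x y hx hy => rw [map_add]; exact H.add_mem hx hy
  · intro x hx
    obtain ⟨n, g, hn, hg⟩ := exists_smul_eq_one_tmul x
    obtain ⟨U, rfl⟩ := cls_surjective C g
    have hU : U ∈ objectsOver C H := by
      change (1 : ℚ) ⊗ₜ[ℤ] cls C U ∈ H
      rw [← hg]
      exact H.smul_mem _ hx
    rw [← Submodule.smul_mem_iff _ (Nat.cast_ne_zero.2 hn : (n : ℚ) ≠ 0), hg]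
    exact ⟨1 ⊗ₜ QuotientAddGroup.mk (FreeAbelianGroup.of ⟨U, hU⟩), rfl⟩

end

/-- every `ℚ`-subspace of `G(C)_ℚ` is the image of `δ^D_ℚ` for some radical
dense subcategory `D` of `C`. -/
theorem exists_radical_dense_subcategory_of_subspace (H : Submodule ℚ (ℚ ⊗[ℤ] G C)) :
    ∃ S : Set C, IsTriangulatedSubcat C S ∧ DenseSub C S ∧ RadicalSub C S ∧
      LinearMap.range (deltaQ C S) = H :=
  ⟨objectsOver C H, isTriangulatedSubcat_objectsOver C H, denseSub_objectsOver C H,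
    radicalSub_objectsOver C H, range_deltaQ_objectsOver C H⟩


end GrothendieckPaper
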